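/- Let n, k, ℓ be integers with n ≥ 10, k ≥ 10, ℓ ≥ 10, and set a := (1/√2, 1/√2) ∈ ℝ². Suppose there exist u, v ∈ ℝ² such that 2^{k²−1} ≤ ‖u‖ ≤ 2^{k²+1}, 2^{ℓ²−1} ≤ ‖v‖ ≤ 2^{ℓ²+1}, and ‖u + v − 2^{n²} a‖ ≤ 2^{n²−10}. Then exactly one of the following holds: (ℓ = n and 10 ≤ k ≤ n−1), or (k = n and 10 ≤ ℓ ≤ n−1), or (k = ℓ and k ≥ n). -/

import Mathlib

open MeasureTheory Complex
open scoped RealInnerProductSpace ENNReal NNReal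

noncomputable section

abbrev E2 : Type := EuclideanSpace ℝ (Fin 2)

/-- Rotation by 90 degrees: `η^⊥ = (-η₂, η₁)`. -/
def perp (η : E2) : E2 := (WithLp.equiv 2 (Fin 2 → ℝ)).symm ![-η 1, η 0]

/-- The first standard basis vector `e₁ = (1,0)`. -/
def e1 : E2 := EuclideanSpace.single 0 1

/-- The unit vector `a = (1/√2, 1/√2)`. -/
def aVec : E2 := (WithLp.equiv 2 (Fin 2 → ℝ)).symm ![1 / Real.sqrt 2, 1 / Real.sqrt 2]

/-- Fourier transform `ĥ(ξ) = ∫ e^{-i x·ξ} h(x) dx`. -/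
def FT (h : E2 → ℂ) (ξ : E2) : ℂ :=
  ∫ x : E2, Complex.exp (-(Complex.I * ((⟪x, ξ⟫ : ℝ) : ℂ))) * h x

/-- The numbers `2 ^ m ^ 2` are lacunary, with ratio at least `2 ^ 10` once `10 ≤ m`. -/
lemma two_zpow_sq_lacunary {m p : ℕ} (hm : 10 ≤ m) (hmp : m < p) :
    1024 * (2 : ℝ) ^ ((m : ℤ) ^ 2) ≤ (2 : ℝ) ^ ((p : ℤ) ^ 2) := by
  have h : (10 : ℤ) + (m : ℤ) ^ 2 ≤ (p : ℤ) ^ 2 := by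
    have h1 : (m : ℤ) + 1 ≤ p := by exact_mod_cast hmp
    have h2 : (10 : ℤ) ≤ m := by exact_mod_cast hm
    nlinarith
  calc 1024 * (2 : ℝ) ^ ((m : ℤ) ^ 2) = (2 : ℝ) ^ ((10 : ℤ) + (m : ℤ) ^ 2) := by
        rw [zpow_add₀ (by norm_num)]; norm_num
    _ ≤ (2 : ℝ) ^ ((p : ℤ) ^ 2) := zpow_le_zpow_right₀ (by norm_num) h

lemma norm_aVec : ‖aVec‖ = 1 := by
  rw [EuclideanSpace.norm_eq]
  simp [aVec, Fin.sum_univ_two]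
  norm_num

/-- frequency-pairing lemma. If annuli of radii `2^{k²}`, `2^{ℓ²}`
can add up to a frequency near `2^{n²}a`, then `(k,ℓ)` pairs in one
(and exactly one, the cases being mutually exclusive) of three ways. -/
theorem stmt14 (n k l : ℕ) (hn : 10 ≤ n) (hk : 10 ≤ k) (hl : 10 ≤ l)
    (u v : E2)
    (hu1 : (2 : ℝ) ^ ((k : ℤ) ^ 2 - 1) ≤ ‖u‖) (hu2 : ‖u‖ ≤ (2 : ℝ) ^ ((k : ℤ) ^ 2 + 1))
    (hv1 : (2 : ℝ) ^ ((l : ℤ) ^ 2 - 1) ≤ ‖v‖) (hv2 : ‖v‖ ≤ (2 : ℝ) ^ ((l : ℤ) ^ 2 + 1))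
    (hsum : ‖u + v - (2 : ℝ) ^ ((n : ℤ) ^ 2) • aVec‖ ≤ (2 : ℝ) ^ ((n : ℤ) ^ 2 - 10)) :
    (l = n ∧ 10 ≤ k ∧ k ≤ n - 1) ∨ (k = n ∧ 10 ≤ l ∧ l ≤ n - 1) ∨
      (k = l ∧ n ≤ k) := by
  have h2 : (2 : ℝ) ≠ 0 := two_ne_zero
  have hK : (0 : ℝ) < (2 : ℝ) ^ ((k : ℤ) ^ 2) := by positivity
  have hL : (0 : ℝ) < (2 : ℝ) ^ ((l : ℤ) ^ 2) := by positivity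
  have hN : (0 : ℝ) < (2 : ℝ) ^ ((n : ℤ) ^ 2) := by positivity
  have hna : ‖(2 : ℝ) ^ ((n : ℤ) ^ 2) • aVec‖ = (2 : ℝ) ^ ((n : ℤ) ^ 2) := by
    rw [norm_smul, norm_aVec, mul_one, Real.norm_of_nonneg hN.le]
  have hw1 := norm_sub_norm_le (u + v) ((2 : ℝ) ^ ((n : ℤ) ^ 2) • aVec)
  have hw2 := norm_sub_norm_le ((2 : ℝ) ^ ((n : ℤ) ^ 2) • aVec) (u + v)
  rw [norm_sub_rev] at hw2
  rw [hna] at hw1 hw2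
  have huv := norm_add_le u v
  have hu := norm_sub_le (u + v) v
  have hv := norm_sub_le (u + v) u
  rw [add_sub_cancel_right] at hu
  rw [add_sub_cancel_left] at hv
  rw [zpow_sub₀ h2] at hu1 hv1 hsum
  rw [zpow_add₀ h2] at hu2 hv2
  norm_num at hu1 hu2 hv1 hv2 hsum
  have hkl := @two_zpow_sq_lacunary k l hk
  have hlk := @two_zpow_sq_lacunary l k hl
  have hkn := @two_zpow_sq_lacunary k n hk
  have hnk := @two_zpow_sq_lacunary n k hn
  have hln := @two_zpow_sq_lacunary l n hl
  have hnl := @two_zpow_sq_lacunary n l hn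
  rcases lt_trichotomy k l with h | h | h
  · have h1 := hkl h
    rcases lt_trichotomy l n with h' | h' | h'
    · have := hln h'
      linarith
    · omega
    · have := hnl h'
      linarith
  · subst h
    rcases lt_or_ge k n with h' | h'
    · have := hkn h'
      linarith
    · omega
  · have h1 := hlk h
    rcases lt_trichotomy k n with h' | h' | h'
    · have := hkn h'
      linarith
    · omega
    · have := hnk h'
      linarith
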